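/- For a constant-coefficient divergence-free linear vector field w on a tetrahedron K (i.e. w affine, div w = 0), the quadrature error of the vertex–face-midpoint rule applied to w · ∇b vanishes, where b = λ_1 λ_2 λ_3 λ_4 is the quartic bubble: ∫_K w·∇b dx = |K| ( Σ_{i=1}^4 (1/40) (w·∇b)(v_i) + Σ_{i=1}^4 (9/40) (w·∇b)(f_i) ). -/

import Mathlib

noncomputable section
open MeasureTheory Finset

abbrev V3 : Type := Fin 3 → ℝ

def dot3 (a b : V3) : ℝ := ∑ i, a i * b i

def pd (f : V3 → ℝ) (i : Fin 3) (x : V3) : ℝ :=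
  fderiv ℝ f x (fun j => if j = i then (1:ℝ) else 0)

def curl3 (u : V3 → V3) (x : V3) : V3 :=
  ![pd (fun y => u y 2) 1 x - pd (fun y => u y 1) 2 x,
    pd (fun y => u y 0) 2 x - pd (fun y => u y 2) 0 x,
    pd (fun y => u y 1) 0 x - pd (fun y => u y 0) 1 x]

/-- Product of two Lipschitz functions with values in `[0,1]`. -/
lemma lip_mul {f g : V3 → ℝ} {C D : NNReal} (hf : LipschitzWith C f) (hg : LipschitzWith D g)
    (f0 : ∀ x, 0 ≤ f x) (f1 : ∀ x, f x ≤ 1) (g0 : ∀ x, 0 ≤ g x) (g1 : ∀ x, g x ≤ 1) :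
    LipschitzWith (C + D) (fun x => f x * g x) := by
  apply LipschitzWith.of_dist_le_mul
  intro x y
  have h1 := hf.dist_le_mul x y
  have h2 := hg.dist_le_mul x y
  rw [Real.dist_eq] at h1 h2 ⊢
  have e : f x * g x - f y * g y = (f x - f y) * g x + f y * (g x - g y) := by ring
  rw [e]
  refine (abs_add_le _ _).trans ?_
  rw [abs_mul, abs_mul, abs_of_nonneg (g0 x), abs_of_nonneg (f0 y)]
  have h3 : |f x - f y| * g x ≤ |f x - f y| := mul_le_of_le_one_right (abs_nonneg _) (g1 x)
  have h4 : f y * |g x - g y| ≤ |g x - g y| := mul_le_of_le_one_left (abs_nonneg _) (f1 y)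
  push_cast
  linarith

lemma unit_mul {a b : ℝ} (ha : 0 ≤ a ∧ a ≤ 1) (hb : 0 ≤ b ∧ b ≤ 1) :
    0 ≤ a * b ∧ a * b ≤ 1 :=
  ⟨mul_nonneg ha.1 hb.1, mul_le_one₀ ha.2 hb.1 hb.2⟩

/-- The linear functional `dot3 a`. -/
def dotL (a : V3) : V3 →L[ℝ] ℝ := ∑ k, a k • ContinuousLinearMap.proj (R := ℝ) k

lemma dotL_apply (a x : V3) : dotL a x = dot3 a x := by
  simp [dotL, dot3]

set_option maxHeartbeats 1000000 in
/-- For a divergence-free affine vector field `w`, the quadrature error of the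
vertex–face-barycenter rule applied to `w · ∇b` vanishes, where
`b = λ_1 λ_2 λ_3 λ_4` is the quartic bubble. -/
theorem stmt_7 (v : Fin 4 → V3) (hv : AffineIndependent ℝ v)
    (f : Fin 4 → V3) (hf : ∀ ℓ, f ℓ = (3:ℝ)⁻¹ • ∑ m ∈ univ.erase ℓ, v m)
    (lam : Fin 4 → V3 → ℝ) (grad : Fin 4 → V3) (c : Fin 4 → ℝ)
    (hlam : ∀ i x, lam i x = dot3 (grad i) x + c i)
    (hdelta : ∀ i j, lam i (v j) = if i = j then (1:ℝ) else 0)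
    (hsum : ∀ x, ∑ i, lam i x = 1)
    (b : V3 → ℝ) (hb : ∀ x, b x = ∏ m, lam m x)
    (w : V3 → V3) (A : V3 →ₗ[ℝ] V3) (b0 : V3)
    (hw : ∀ x, w x = A x + b0)
    (hdiv : ∀ x, ∑ i, pd (fun y => w y i) i x = 0) :
    ∫ x in convexHull ℝ (Set.range v), fderiv ℝ b x (w x) =
      (volume (convexHull ℝ (Set.range v))).toReal *
        (∑ i, (1/40 : ℝ) * fderiv ℝ b (v i) (w (v i)) +
         ∑ i, (9/40 : ℝ) * fderiv ℝ b (f i) (w (f i))) := by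
  classical
  -- barycentric coordinates
  have htop : affineSpan ℝ (Set.range v) = ⊤ := by
    rw [hv.affineSpan_eq_top_iff_card_eq_finrank_add_one]; simp
  let B : AffineBasis (Fin 4) ℝ V3 := ⟨v, hv, htop⟩
  have hBv : (B : Fin 4 → V3) = v := rfl
  have hlamL : ∀ i x, lam i x = dotL (grad i) x + c i := by
    intro i x; rw [dotL_apply, hlam]
  have hcoord : ∀ i x, B.coord i x = lam i x := by
    intro i x
    have h1 : ∑ j, B.coord j x • v j = x := B.linear_combination_coord_eq_self x
    have h2 : ∑ j, B.coord j x = 1 := B.sum_coord_apply_eq_one x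
    have h3 : lam i x = ∑ j, B.coord j x * lam i (v j) := by
      simp_rw [hlamL, mul_add, Finset.sum_add_distrib, ← Finset.sum_mul, h2]
      conv_lhs => rw [← h1]
      simp
    rw [h3]
    simp [hdelta]
  have hrep : ∀ x, ∑ j, lam j x • v j = x := by
    intro x
    simp_rw [← hcoord]
    exact B.linear_combination_coord_eq_self x
  set K := convexHull ℝ (Set.range v) with hK
  have hKmem : ∀ x, x ∈ K ↔ ∀ i, 0 ≤ lam i x := by
    intro x
    have := B.convexHull_eq_nonneg_coord
    rw [hBv] at this
    rw [hK, this]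
    simp [hcoord]
  have hKint : ∀ x, x ∈ interior K ↔ ∀ i, 0 < lam i x := by
    intro x
    have := B.interior_convexHull
    rw [hBv] at this
    rw [hK, this]
    simp [hcoord]
  have hKcomp : IsCompact K := (Set.finite_range v).isCompact_convexHull ℝ
  -- trace
  set E : Fin 3 → V3 := fun i j => if j = i then (1:ℝ) else 0 with hE
  have hdotE : ∀ a k, dotL a (E k) = a k := by
    intro a k; rw [dotL_apply]; simp [dot3, hE]
  have hEk : ∀ k, E k = ∑ i, grad i k • v i := by
    intro k
    have h1 := hrep (E k)
    have h0 := hrep 0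
    simp_rw [hlamL, hdotE, add_smul, Finset.sum_add_distrib] at h1
    simp_rw [hlamL, map_zero, zero_add] at h0
    rw [h0, add_zero] at h1
    exact h1.symm
  have hwi : ∀ (i : Fin 3) (x : V3), HasFDerivAt (fun y => w y i)
      ((ContinuousLinearMap.proj (R := ℝ) i).comp (LinearMap.toContinuousLinearMap A)) x := by
    intro i x
    have : (fun y => w y i) = fun y => ((ContinuousLinearMap.proj (R := ℝ) i).comp
        (LinearMap.toContinuousLinearMap A)) y + b0 i := by
      funext y; simp [hw]
    rw [this]
    exact (ContinuousLinearMap.hasFDerivAt _).add_const _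
  have htr : ∑ k, A (E k) k = 0 := by
    have := hdiv 0
    simp only [pd] at this
    simp_rw [(hwi _ _).fderiv] at this
    simpa [hE] using this
  have htr2 : ∑ i, dot3 (grad i) (A (v i)) = 0 := by
    rw [← htr]
    simp_rw [hEk, map_sum, map_smul, dot3]
    rw [Finset.sum_comm]
    simp
  have hgsum : ∀ x, ∑ i, dotL (grad i) x = 0 := by
    intro x
    have h1 := hsum x
    have h0 := hsum 0
    simp_rw [hlamL, Finset.sum_add_distrib] at h1 h0
    simp at h0
    linarith
  -- derivative of b
  have hlamD : ∀ i x, HasFDerivAt (lam i) (dotL (grad i)) x := by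
    intro i x
    have : lam i = fun y => dotL (grad i) y + c i := funext (hlamL i)
    rw [this]
    exact (ContinuousLinearMap.hasFDerivAt _).add_const _
  have hbeq : b = fun x => lam 0 x * lam 1 x * lam 2 x * lam 3 x := by
    funext x; rw [hb, Fin.prod_univ_four]
  have hlamc : ∀ i, ContDiff ℝ 1 (lam i) := by
    intro i
    have : lam i = fun y => dotL (grad i) y + c i := funext (hlamL i)
    rw [this]
    fun_prop
  have hbc : ContDiff ℝ 1 b := by
    rw [hbeq]
    exact (((hlamc 0).mul (hlamc 1)).mul (hlamc 2)).mul (hlamc 3)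
  have hbD : ∀ x u, fderiv ℝ b x u =
      lam 1 x * lam 2 x * lam 3 x * dotL (grad 0) u + lam 0 x * lam 2 x * lam 3 x * dotL (grad 1) u
      + lam 0 x * lam 1 x * lam 3 x * dotL (grad 2) u
      + lam 0 x * lam 1 x * lam 2 x * dotL (grad 3) u := by
    intro x u
    have h := (((hlamD 0 x).mul (hlamD 1 x)).mul (hlamD 2 x)).mul (hlamD 3 x)
    rw [hbeq]
    erw [h.fderiv]
    simp
    ring
  -- right-hand side vanishes
  have hlamf : ∀ m l, lam m (f l) = if m = l then 0 else 1/3 := by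
    intro m l
    have h1 : lam m (f l) = (3:ℝ)⁻¹ * ∑ j ∈ univ.erase l, lam m (v j) := by
      simp_rw [hlamL, hf, Finset.sum_add_distrib]
      simp [Finset.card_erase_of_mem]
      ring
    rw [h1]
    simp_rw [hdelta]
    rw [Finset.sum_ite_eq]
    by_cases h : m = l <;> simp [h]
  have hR1 : ∀ i, fderiv ℝ b (v i) (w (v i)) = 0 := by
    intro i
    rw [hbD]
    simp_rw [hdelta]
    fin_cases i <;> simp
  have hR2 : ∀ i, fderiv ℝ b (f i) (w (f i)) = 1/27 * dotL (grad i) (w (f i)) := by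
    intro i
    rw [hbD]
    simp_rw [hlamf]
    fin_cases i <;> simp <;> norm_num
  have hfv : ∀ i, f i = (3:ℝ)⁻¹ • (∑ m, v m) - (3:ℝ)⁻¹ • v i := by
    intro i
    rw [hf, ← smul_sub, ← Finset.sum_erase_add _ _ (Finset.mem_univ i), add_sub_cancel_right]
  have hR3 : ∑ i, dotL (grad i) (w (f i)) = 0 := by
    have h1 : ∀ i, dotL (grad i) (w (f i)) =
        dotL (grad i) (A ((3:ℝ)⁻¹ • (∑ m, v m)) + b0) - (3:ℝ)⁻¹ * dot3 (grad i) (A (v i)) := by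
      intro i
      rw [hw, hfv i, map_sub, ← dotL_apply, map_smul A _ (v i), map_add, map_sub, map_add,
        map_smul (dotL (grad i)) _ (A (v i)), smul_eq_mul]
      ring
    simp_rw [h1, Finset.sum_sub_distrib, hgsum, ← Finset.mul_sum, htr2]
    simp
  have hR : (∑ i, (1/40 : ℝ) * fderiv ℝ b (v i) (w (v i)) +
         ∑ i, (9/40 : ℝ) * fderiv ℝ b (f i) (w (f i))) = 0 := by
    simp_rw [hR1, hR2, ← Finset.mul_sum, hR3]
    simp
  rw [hR, mul_zero]
  -- left-hand side vanishes: cut-off bubble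
  set cl : Fin 4 → V3 → ℝ := fun i x => max 0 (min 1 (lam i x)) with hcl
  have hcl01 : ∀ i x, 0 ≤ cl i x ∧ cl i x ≤ 1 := by
    intro i x; exact ⟨le_max_left _ _, max_le zero_le_one (min_le_left _ _)⟩
  have hclip : ∀ i, ∃ C, LipschitzWith C (cl i) := by
    intro i
    have h : LipschitzWith ‖dotL (grad i)‖₊ (lam i) := by
      have h0 := (dotL (grad i)).lipschitz
      apply LipschitzWith.of_dist_le_mul
      intro x y
      rw [hlamL, hlamL, dist_add_right]
      exact h0.dist_le_mul x y
    exact ⟨_, (h.const_min 1).const_max 0⟩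
  choose C hC using hclip
  set G : V3 → ℝ := fun x => cl 0 x * cl 1 x * cl 2 x * cl 3 x with hG
  have hGlip : LipschitzWith (C 0 + C 1 + C 2 + C 3) G := by
    have u1 := fun x => unit_mul (hcl01 0 x) (hcl01 1 x)
    have u2 := fun x => unit_mul (u1 x) (hcl01 2 x)
    have l1 := lip_mul (hC 0) (hC 1) (fun x => (hcl01 0 x).1) (fun x => (hcl01 0 x).2)
      (fun x => (hcl01 1 x).1) (fun x => (hcl01 1 x).2)
    have l2 := lip_mul l1 (hC 2) (fun x => (u1 x).1) (fun x => (u1 x).2)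
      (fun x => (hcl01 2 x).1) (fun x => (hcl01 2 x).2)
    exact lip_mul l2 (hC 3) (fun x => (u2 x).1) (fun x => (u2 x).2)
      (fun x => (hcl01 3 x).1) (fun x => (hcl01 3 x).2)
  have hGout : ∀ x, x ∉ K → G x = 0 := by
    intro x hx
    rw [hKmem] at hx
    push Not at hx
    obtain ⟨i, hi⟩ := hx
    have h0 : cl i x = 0 := max_eq_left ((min_le_right _ _).trans hi.le)
    change cl 0 x * cl 1 x * cl 2 x * cl 3 x = 0
    have h4 : ∏ j, cl j x = 0 := Finset.prod_eq_zero (Finset.mem_univ i) h0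
    rwa [Fin.prod_univ_four] at h4
  have hGin : ∀ x, x ∈ K → G x = b x := by
    intro x hx
    rw [hKmem] at hx
    have h1 : ∀ i, lam i x ≤ 1 := by
      intro i
      rw [← hsum x]
      exact Finset.single_le_sum (f := fun i => lam i x) (fun j _ => hx j) (Finset.mem_univ i)
    have h2 : ∀ i, cl i x = lam i x := by
      intro i
      simp only [hcl]
      rw [min_eq_right (h1 i), max_eq_right (hx i)]
    simp only [hG, h2, hbeq]
  have hGsupp : HasCompactSupport G := HasCompactSupport.intro hKcomp hGout
  have hfront : volume (frontier K) = 0 := (convex_convexHull ℝ _).addHaar_frontier volume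
  have hwlip : ∀ i : Fin 3, ∃ D, LipschitzWith D (fun y => w y i) := by
    intro i
    refine ⟨_, lipschitzWith_of_nnnorm_fderiv_le (𝕜 := ℝ)
      (fun x => (hwi i x).differentiableAt) (C := ‖(ContinuousLinearMap.proj (R := ℝ) i).comp
        (LinearMap.toContinuousLinearMap A)‖₊) ?_⟩
    intro x
    rw [(hwi i x).fderiv]
  have hpart : ∀ i : Fin 3, ∫ x in K, fderiv ℝ b x (E i) * w x i = - (A (E i) i * ∫ x, G x) := by
    intro i
    obtain ⟨D, hD⟩ := hwlip i
    have h := LipschitzWith.integral_lineDeriv_mul_eq (μ := volume) hD hGlip hGsupp (E i)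
    have e1 : ∀ x, lineDeriv ℝ (fun y => w y i) x (E i) = A (E i) i := by
      intro x
      rw [(hwi i x).differentiableAt.lineDeriv_eq_fderiv, (hwi i x).fderiv]
      simp
    simp_rw [e1, integral_const_mul] at h
    rw [h, ← integral_neg, ← integral_indicator hKcomp.measurableSet]
    apply integral_congr_ae
    have hae : ∀ᵐ x ∂(volume : Measure V3), x ∉ frontier K := measure_eq_zero_iff_ae_notMem.1 hfront
    filter_upwards [hae] with x hx
    by_cases hxK : x ∈ K
    · have hxi : x ∈ interior K := by
        by_contra hn
        exact hx ⟨subset_closure hxK, hn⟩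
      have hev : G =ᶠ[nhds x] b := by
        filter_upwards [isOpen_interior.mem_nhds hxi] with y hy
        exact hGin y (interior_subset hy)
      rw [Set.indicator_of_mem hxK, hev.lineDeriv_eq,
        ((hbc.differentiable (by simp)) x).lineDeriv_eq_fderiv]
      simp
    · have hev : G =ᶠ[nhds x] fun _ => 0 := by
        filter_upwards [hKcomp.isClosed.isOpen_compl.mem_nhds hxK] with y hy
        exact hGout y hy
      rw [Set.indicator_of_notMem hxK, hev.lineDeriv_eq]
      simp [lineDeriv]
  have hexp : ∀ x, fderiv ℝ b x (w x) = ∑ i, fderiv ℝ b x (E i) * w x i := by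
    intro x
    have : w x = ∑ i, w x i • E i := by
      funext j; simp [hE]
    conv_lhs => rw [this]
    simp [mul_comm]
  simp_rw [hexp]
  rw [integral_finsetSum]
  · simp_rw [hpart, Finset.sum_neg_distrib, ← Finset.sum_mul, htr]
    simp
  · intro i _
    apply ContinuousOn.integrableOn_compact hKcomp
    apply Continuous.continuousOn
    have h1 : Continuous (fderiv ℝ b) := hbc.continuous_fderiv (by simp)
    have h2 : Continuous (fun x => w x i) :=
      continuous_iff_continuousAt.2 fun x => (hwi i x).continuousAt
    exact (h1.clm_apply continuous_const).mul h2
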